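/- Let h : [0,1]² → ℝ be bounded with bounded first partial derivatives, let 0 < A < 1, and set g(u₁,u₂) = u₁^{−A}u₂^{−A/2} h((1−u₁)√u₂, √u₂). Then there exists B' < ∞ such that |∂g/∂u₂ (u)| ≤ B' u₁^{−A}u₂^{−A/2−1} for all u ∈ (0,1)². -/

import Mathlib

open MeasureTheory Set

/-- Partial derivative with respect to the first coordinate. -/
noncomputable def pd1 (g : ℝ × ℝ → ℝ) (x : ℝ × ℝ) : ℝ :=
  deriv (fun t => g (t, x.2)) x.1

/-- Partial derivative with respect to the second coordinate. -/
noncomputable def pd2 (g : ℝ × ℝ → ℝ) (x : ℝ × ℝ) : ℝ :=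
  deriv (fun t => g (x.1, t)) x.2

/-- The chain rule along a plane curve, written with the two coordinate partial derivatives. -/
theorem hasDerivAt_comp_curve {h : ℝ × ℝ → ℝ} {a b : ℝ → ℝ} {a' b' t : ℝ}
    (hh : DifferentiableAt ℝ h (a t, b t)) (ha : HasDerivAt a a' t) (hb : HasDerivAt b b' t) :
    HasDerivAt (fun s => h (a s, b s))
      (a' * pd1 h (a t, b t) + b' * pd2 h (a t, b t)) t := by
  have hf := hh.hasFDerivAt
  have h1 : pd1 h (a t, b t) = fderiv ℝ h (a t, b t) (1, 0) :=
    (hf.comp_hasDerivAt (a t) ((hasDerivAt_id (a t)).prodMk (hasDerivAt_const (a t) (b t)))).deriv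
  have h2 : pd2 h (a t, b t) = fderiv ℝ h (a t, b t) (0, 1) :=
    (hf.comp_hasDerivAt (b t) ((hasDerivAt_const (b t) (a t)).prodMk (hasDerivAt_id (b t)))).deriv
  have key : fderiv ℝ h (a t, b t) (a', b') =
      a' * pd1 h (a t, b t) + b' * pd2 h (a t, b t) := by
    have hv : ((a', b') : ℝ × ℝ) = a' • (1, 0) + b' • (0, 1) := by simp
    rw [h1, h2, hv, map_add, map_smul, map_smul, smul_eq_mul, smul_eq_mul]
  rw [← key]
  exact hf.comp_hasDerivAt t (ha.prodMk hb)

/-- For `g(u) = u₁^{−A}u₂^{−A/2} h((1−u₁)√u₂, √u₂)` with `h` bounded with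
bounded first partials, `∂g/∂u₂` satisfies the lower-edge singularity bound
`B' u₁^{−A} u₂^{−A/2−1}`. -/
theorem transformed_bound_du2
    (A : ℝ) (hA : 0 < A) (hA1 : A < 1)
    (h : ℝ × ℝ → ℝ) (hsmooth : ContDiff ℝ 1 h)
    (M : ℝ) (hbdd : ∀ x : ℝ × ℝ, x ∈ Icc (0:ℝ) 1 ×ˢ Icc (0:ℝ) 1 →
      |h x| ≤ M ∧ |pd1 h x| ≤ M ∧ |pd2 h x| ≤ M) :
    ∃ B' : ℝ, ∀ u : ℝ × ℝ, u ∈ Ioo (0:ℝ) 1 ×ˢ Ioo (0:ℝ) 1 →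
      (letI g : ℝ × ℝ → ℝ := fun v =>
        v.1 ^ (-A) * v.2 ^ (-A/2) * h ((1 - v.1) * Real.sqrt v.2, Real.sqrt v.2)
      |pd2 g u| ≤ B' * u.1 ^ (-A) * u.2 ^ (-A/2 - 1)) := by
  refine ⟨(A / 2 + 1) * M, ?_⟩
  rintro ⟨x, t⟩ ⟨⟨hx0, hx1⟩, ht0, ht1⟩
  dsimp only at hx0 hx1 ht0 ht1 ⊢
  have hs0 : 0 < √t := Real.sqrt_pos.2 ht0
  have hs1 : √t ≤ 1 := Real.sqrt_le_one.2 ht1.le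
  have hss : √t * √t = t := Real.mul_self_sqrt ht0.le
  obtain ⟨b0, b1, b2⟩ := hbdd ((1 - x) * √t, √t)
    ⟨⟨by nlinarith, by nlinarith⟩, hs0.le, hs1⟩
  have hsqrt : HasDerivAt (fun s : ℝ => √s) (1 / (2 * √t)) t := Real.hasDerivAt_sqrt ht0.ne'
  have hcurve := hasDerivAt_comp_curve (a := fun s => (1 - x) * √s) (b := fun s => √s)
    (hsmooth.differentiable one_ne_zero _) (hsqrt.const_mul (1 - x)) hsqrt
  have hpow := (Real.hasDerivAt_rpow_const (x := t) (p := -A / 2) (Or.inl ht0.ne')).const_mul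
    (x ^ (-A))
  have hd := (hpow.mul hcurve).deriv
  have hpd : pd2 (fun v : ℝ × ℝ => v.1 ^ (-A) * v.2 ^ (-A / 2) *
      h ((1 - v.1) * √v.2, √v.2)) (x, t) = _ := hd
  rw [hpd]
  set H := h ((1 - x) * √t, √t)
  set P := pd1 h ((1 - x) * √t, √t)
  set Q := pd2 h ((1 - x) * √t, √t)
  have ht : t ^ (-A / 2) = t ^ (-A / 2 - 1) * (√t * √t) := by
    rw [hss, Real.rpow_sub_one ht0.ne', div_mul_cancel₀ _ ht0.ne']
  have hX : 0 < x ^ (-A) := Real.rpow_pos_of_pos hx0 _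
  have hT : 0 < t ^ (-A / 2 - 1) := Real.rpow_pos_of_pos ht0 _
  have hfactor : x ^ (-A) * (-A / 2 * t ^ (-A / 2 - 1)) * H + x ^ (-A) * t ^ (-A / 2) *
      ((1 - x) * (1 / (2 * √t)) * P + 1 / (2 * √t) * Q) =
      x ^ (-A) * t ^ (-A / 2 - 1) * (-(A / 2) * H + √t / 2 * ((1 - x) * P + Q)) := by
    rw [ht]
    field_simp
  rw [hfactor, abs_mul, abs_of_pos (mul_pos hX hT)]
  have hM : 0 ≤ M := (abs_nonneg _).trans b0
  have hPQ : |(1 - x) * P + Q| ≤ 2 * M := by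
    refine (abs_add_le _ _).trans ?_
    rw [abs_mul, abs_of_pos (sub_pos.2 hx1)]
    nlinarith [abs_nonneg P]
  have hbound : |-(A / 2) * H + √t / 2 * ((1 - x) * P + Q)| ≤ (A / 2 + 1) * M := by
    refine (abs_add_le _ _).trans ?_
    rw [abs_mul, abs_mul, abs_neg, abs_of_pos (half_pos hA), abs_of_pos (half_pos hs0)]
    nlinarith [abs_nonneg ((1 - x) * P + Q)]
  calc _ ≤ x ^ (-A) * t ^ (-A / 2 - 1) * ((A / 2 + 1) * M) := by gcongr
    _ = _ := by ring
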